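/- Let N ≥ 1 and let y ∈ ℝ^N. The minimum of the binning criterion over all consecutive-block partitions of {1,…,N} whose block means are nondecreasing equals (1/N) times the minimum of ∑_{i=1}^{N}(y_i − g_i)² over all nondecreasing g ∈ ℝ^N, and this minimum is attained at the partition given by the maximal constant blocks of the isotonic least-squares fit of y. -/

import Mathlib

open Finset

/-- Mean of `y` over the consecutive block `[a, c)`. -/
noncomputable def blockMean (y : ℕ → ℝ) (a c : ℕ) : ℝ :=
  (∑ i ∈ Finset.Ico a c, y i) / ((c - a : ℕ) : ℝ)

/-- Within-block variance of `y` over the consecutive block `[a, c)`. -/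
noncomputable def blockVar (y : ℕ → ℝ) (a c : ℕ) : ℝ :=
  (∑ i ∈ Finset.Ico a c, (y i - blockMean y a c) ^ 2) / ((c - a : ℕ) : ℝ)

/-- The binning criterion of the consecutive-block partition of `{0, …, N-1}`
with cut indices `n 0 = 0 < n 1 < ⋯ < n B = N`:
the weighted (by block size over `N`) sum of within-block variances. -/
noncomputable def binCrit (y : ℕ → ℝ) (N B : ℕ) (n : ℕ → ℕ) : ℝ :=
  ∑ b ∈ Finset.range B,
    (((n (b + 1) - n b : ℕ) : ℝ) / (N : ℝ)) * blockVar y (n b) (n (b + 1))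

/-- `n` is a sequence of cut indices for a consecutive-block partition of
`{0, …, N-1}` into `B` blocks. -/
def IsCutSeq (N B : ℕ) (n : ℕ → ℕ) : Prop :=
  n 0 = 0 ∧ n B = N ∧ ∀ b < B, n b < n (b + 1)

/-- `g` is nondecreasing on the index range `{0, …, N-1}`. -/
def MonotoneOnRange (N : ℕ) (g : ℕ → ℝ) : Prop :=
  ∀ i j : ℕ, i ≤ j → j < N → g i ≤ g j

/-- `g` is an isotonic least-squares fit of `y` on `{0, …, N-1}`: it is
nondecreasing and minimises the squared Euclidean distance to `y` over all
nondecreasing vectors. -/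
def IsIsotonicFit (N : ℕ) (y g : ℕ → ℝ) : Prop :=
  MonotoneOnRange N g ∧
    ∀ h : ℕ → ℝ, MonotoneOnRange N h →
      ∑ i ∈ Finset.range N, (y i - g i) ^ 2 ≤ ∑ i ∈ Finset.range N, (y i - h i) ^ 2

/-- The cut sequence `n` lists the maximal constant blocks of `g` on
`{0, …, N-1}` in increasing order: `g` is constant on each block and its value
changes across every interior boundary. -/
def IsMaxBlockPartition (N B : ℕ) (g : ℕ → ℝ) (n : ℕ → ℕ) : Prop :=
  IsCutSeq N B n ∧
    (∀ b < B, ∀ i ∈ Finset.Ico (n b) (n (b + 1)), ∀ j ∈ Finset.Ico (n b) (n (b + 1)), g i = g j) ∧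
    (∀ b, 0 < b → b < B → g (n b - 1) ≠ g (n b))

/-- Cut indices are nondecreasing. -/
lemma IsCutSeq.le_of_le {N B : ℕ} {n : ℕ → ℕ} (hn : IsCutSeq N B n) {b c : ℕ}
    (hbc : b ≤ c) (hc : c ≤ B) : n b ≤ n c := by
  induction c, hbc using Nat.le_induction with
  | base => exact le_rfl
  | succ k _ ih => exact (ih (by omega)).trans (hn.2.2 k (by omega)).le

/-- A sum over `{0, …, N-1}` splits along the blocks of a partition. -/
lemma IsCutSeq.sum_blocks {N B : ℕ} {n : ℕ → ℕ} (hn : IsCutSeq N B n) (f : ℕ → ℝ) :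
    ∑ b ∈ range B, ∑ i ∈ Ico (n b) (n (b + 1)), f i = ∑ i ∈ range N, f i := by
  have split : ∀ c ≤ B, ∑ b ∈ range c, ∑ i ∈ Ico (n b) (n (b + 1)), f i
      = ∑ i ∈ Ico (n 0) (n c), f i := by
    intro c hc
    induction c with
    | zero => simp
    | succ k ih =>
      rw [sum_range_succ, ih (by omega)]
      exact sum_Ico_consecutive f (hn.le_of_le (Nat.zero_le k) (by omega)) (hn.2.2 k (by omega)).le
  rw [split B le_rfl, hn.1, hn.2.1, range_eq_Ico]

/-- If `h` equals the block mean on every block, the binning criterion is the mean squared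
error of `h`. -/
lemma IsCutSeq.binCrit_eq {N B : ℕ} {n : ℕ → ℕ} (hn : IsCutSeq N B n) (y h : ℕ → ℝ)
    (hmean : ∀ b < B, ∀ i ∈ Ico (n b) (n (b + 1)), h i = blockMean y (n b) (n (b + 1))) :
    binCrit y N B n = (1 / (N : ℝ)) * ∑ i ∈ range N, (y i - h i) ^ 2 := by
  rw [← hn.sum_blocks, mul_sum, binCrit]
  refine sum_congr rfl fun b hb => ?_
  have hb' := mem_range.1 hb
  have hpos : ((n (b + 1) - n b : ℕ) : ℝ) ≠ 0 :=
    Nat.cast_ne_zero.2 (Nat.sub_pos_of_lt (hn.2.2 b hb')).ne'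
  have hsum : ∑ i ∈ Ico (n b) (n (b + 1)), (y i - h i) ^ 2
      = ∑ i ∈ Ico (n b) (n (b + 1)), (y i - blockMean y (n b) (n (b + 1))) ^ 2 :=
    sum_congr rfl fun i hi => by rw [hmean b hb' i hi]
  rw [hsum, blockVar]
  field_simp

/-- A partition with nondecreasing block means has a nondecreasing step function taking the
block mean on every block. -/
lemma IsCutSeq.exists_monotone_step {N B : ℕ} {n : ℕ → ℕ} (hn : IsCutSeq N B n) (hB : 1 ≤ B)
    (y : ℕ → ℝ) (hmono : ∀ b, b + 1 < B →
      blockMean y (n b) (n (b + 1)) ≤ blockMean y (n (b + 1)) (n (b + 2))) :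
    ∃ h : ℕ → ℝ, MonotoneOnRange N h ∧
      ∀ b < B, ∀ i ∈ Ico (n b) (n (b + 1)), h i = blockMean y (n b) (n (b + 1)) := by
  let k : ℕ → ℕ := fun i => Nat.findGreatest (fun b => n b ≤ i) (B - 1)
  have hk_le : ∀ i, k i ≤ B - 1 := fun i => Nat.findGreatest_le _
  have hk_mono : ∀ i j, i ≤ j → k i ≤ k j := fun i j hij =>
    Nat.findGreatest_mono (fun _ hb => le_trans hb hij) le_rfl
  have mean_mono : ∀ b c, b ≤ c → c < B →
      blockMean y (n b) (n (b + 1)) ≤ blockMean y (n c) (n (c + 1)) := by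
    intro b c hbc hc
    induction c, hbc using Nat.le_induction with
    | base => exact le_rfl
    | succ d _ ih => exact (ih (by omega)).trans (hmono d hc)
  refine ⟨fun i => blockMean y (n (k i)) (n (k i + 1)), fun i j hij _ => ?_, fun b hb i hi => ?_⟩
  · exact mean_mono _ _ (hk_mono i j hij) (by have := hk_le j; omega)
  · rw [mem_Ico] at hi
    have hki : k i = b := by
      refine Nat.findGreatest_eq_iff.2 ⟨by omega, fun _ => hi.1, fun c hbc hc hci => ?_⟩
      have := hn.le_of_le (show b + 1 ≤ c from hbc) (by omega)
      omega
    simp only [hki]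

/-- A linear function of `t` dominated by a quadratic one near `0` vanishes. -/
lemma eq_zero_of_forall_abs_le_mul_le_sq {S K δ : ℝ} (hδ : 0 < δ)
    (h : ∀ t, |t| ≤ δ → 2 * t * S ≤ t ^ 2 * K) : S = 0 := by
  have hK : 0 ≤ K := by
    have h₁ := h δ (abs_of_pos hδ).le
    have h₂ := h (-δ) (by rw [abs_neg, abs_of_pos hδ])
    have : 0 ≤ δ ^ 2 * K := by linarith
    exact nonneg_of_mul_nonneg_right this (by positivity)
  have bound : ∀ t, 0 < t → t ≤ δ → 2 * |S| ≤ t * K := by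
    intro t ht htδ
    have h₁ := h t (by rwa [abs_of_pos ht])
    have h₂ := h (-t) (by rwa [abs_neg, abs_of_pos ht])
    refine le_of_mul_le_mul_left ?_ ht
    rcases abs_cases S with ⟨hS, _⟩ | ⟨hS, _⟩ <;> rw [hS] <;> nlinarith
  by_contra hS
  have hS' := abs_pos.2 hS
  have hb := bound (min δ (|S| / (K + 1))) (by positivity) (min_le_left _ _)
  have hmin : min δ (|S| / (K + 1)) * K ≤ |S| / (K + 1) * (K + 1) :=
    mul_le_mul (min_le_right _ _) (by linarith) hK (by positivity)
  rw [div_mul_cancel₀ _ (by positivity)] at hmin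
  linarith

/-- The residuals of an isotonic fit sum to zero over a constant block that is separated from
its neighbours by a positive gap. -/
lemma IsIsotonicFit.sum_residual_eq_zero {N : ℕ} {y g : ℕ → ℝ} (hfit : IsIsotonicFit N y g)
    {a c : ℕ} (hac : a < c) (hc : c ≤ N)
    (hconst : ∀ i ∈ Ico a c, ∀ j ∈ Ico a c, g i = g j)
    {δ : ℝ} (hδ : 0 < δ) (hleft : 0 < a → g (a - 1) + δ ≤ g a)
    (hright : c < N → g (c - 1) + δ ≤ g c) :
    ∑ i ∈ Ico a c, (y i - g i) = 0 := by
  refine eq_zero_of_forall_abs_le_mul_le_sq (K := ((c - a : ℕ) : ℝ)) hδ fun t ht => ?_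
  obtain ⟨htl, htr⟩ := abs_le.1 ht
  have hmono : MonotoneOnRange N (fun i => g i + if i ∈ Ico a c then t else 0) := by
    intro i j hij hj
    have hg := hfit.1 i j hij hj
    by_cases hi : i ∈ Ico a c <;> by_cases hj' : j ∈ Ico a c <;>
      simp only [hi, hj', if_true, if_false]
    · linarith
    · have hcj : c ≤ j := by simp only [mem_Ico] at hi hj'; omega
      have h₁ := hconst i hi (c - 1) (by rw [mem_Ico]; omega)
      have h₂ := hright (by omega)
      have h₃ := hfit.1 c j hcj hj
      linarith
    · have hia : i < a := by simp only [mem_Ico] at hi hj'; omega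
      have h₁ := hconst j hj' a (by rw [mem_Ico]; omega)
      have h₂ := hleft (by omega)
      have h₃ := hfit.1 i (a - 1) (by omega) (by omega)
      linarith
    · linarith
  have hle := hfit.2 _ hmono
  have hexp : ∑ i ∈ range N, (y i - (g i + if i ∈ Ico a c then t else 0)) ^ 2
      = ∑ i ∈ range N, (y i - g i) ^ 2
        + ∑ i ∈ Ico a c, (t ^ 2 - 2 * t * (y i - g i)) := by
    have hsub : Ico a c ⊆ range N := fun i hi => by
      simp only [mem_Ico, mem_range] at hi ⊢; omega
    rw [← inter_eq_right.2 hsub, ← sum_ite_mem, ← sum_add_distrib]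
    refine sum_congr rfl fun i hi => ?_
    simp only [mem_inter, hi, true_and]
    split_ifs <;> ring
  rw [hexp, sum_sub_distrib, ← mul_sum, sum_const, Nat.card_Ico, nsmul_eq_mul] at hle
  linarith

/-- An isotonic fit takes the block mean on each of its maximal constant blocks. -/
lemma IsIsotonicFit.eq_blockMean {N B : ℕ} {y g : ℕ → ℝ} {n : ℕ → ℕ}
    (hfit : IsIsotonicFit N y g) (hpart : IsMaxBlockPartition N B g n) {b : ℕ} (hb : b < B)
    {i : ℕ} (hi : i ∈ Ico (n b) (n (b + 1))) : g i = blockMean y (n b) (n (b + 1)) := by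
  obtain ⟨hn, hconst, hne⟩ := hpart
  have hlt := hn.2.2 b hb
  have hcN : n (b + 1) ≤ N := by
    have := hn.le_of_le (show b + 1 ≤ B from hb) le_rfl
    rwa [hn.2.1] at this
  have gap : ∀ d ≤ B, 0 < n d → n d < N → 0 < g (n d) - g (n d - 1) := by
    intro d hd hpos hdN
    have hd0 : 0 < d := Nat.pos_of_ne_zero fun h => by rw [h, hn.1] at hpos; omega
    have hdB : d < B := lt_of_le_of_ne hd fun h => by rw [h, hn.2.1] at hdN; omega
    exact sub_pos.2 ((hfit.1 _ _ (Nat.sub_le _ _) hdN).lt_of_ne (hne d hd0 hdB))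
  have hgap : ∀ d ≤ B, ∃ δ : ℝ, 0 < δ ∧ (0 < n d → n d < N → g (n d - 1) + δ ≤ g (n d)) := by
    intro d hd
    by_cases h : 0 < n d ∧ n d < N
    · exact ⟨_, gap d hd h.1 h.2, fun _ _ => by linarith⟩
    · exact ⟨1, one_pos, fun h₁ h₂ => absurd ⟨h₁, h₂⟩ h⟩
  obtain ⟨δ, hδ, hl⟩ := hgap b hb.le
  obtain ⟨ε, hε, hr⟩ := hgap (b + 1) hb
  have hzero := hfit.sum_residual_eq_zero hlt hcN (hconst b hb) (lt_min hδ hε)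
    (fun h => by have := hl h (by omega); have := min_le_left δ ε; linarith)
    (fun h => by have := hr (by omega) h; have := min_le_right δ ε; linarith)
  have hpos : ((n (b + 1) - n b : ℕ) : ℝ) ≠ 0 :=
    Nat.cast_ne_zero.2 (Nat.sub_pos_of_lt hlt).ne'
  rw [sum_sub_distrib, sum_congr rfl fun j hj => hconst b hb j hj i hi, sum_const,
    Nat.card_Ico, nsmul_eq_mul] at hzero
  rw [blockMean, eq_div_iff hpos]
  linarith

/-- the minimum of the binning criterion over all
consecutive-block partitions with nondecreasing block means equals `(1/N)`
times the minimal squared distance from `y` to a nondecreasing vector, and it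
is attained at the maximal-constant-block partition of the isotonic
least-squares fit `g*` of `y`. -/
theorem stmt5 (N B : ℕ) (hN : 1 ≤ N) (y gs : ℕ → ℝ) (hfit : IsIsotonicFit N y gs)
    (n : ℕ → ℕ) (hpart : IsMaxBlockPartition N B gs n) :
    (∀ b, b + 1 < B →
      blockMean y (n b) (n (b + 1)) ≤ blockMean y (n (b + 1)) (n (b + 2))) ∧
    binCrit y N B n = (1 / (N : ℝ)) * ∑ i ∈ Finset.range N, (y i - gs i) ^ 2 ∧
    (∀ B' m, 1 ≤ B' → IsCutSeq N B' m →
      (∀ b, b + 1 < B' →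
        blockMean y (m b) (m (b + 1)) ≤ blockMean y (m (b + 1)) (m (b + 2))) →
      binCrit y N B n ≤ binCrit y N B' m) := by
  have hn := hpart.1
  have hmean : ∀ b < B, ∀ i ∈ Ico (n b) (n (b + 1)), gs i = blockMean y (n b) (n (b + 1)) :=
    fun b hb i hi => hfit.eq_blockMean hpart hb hi
  have hcrit := hn.binCrit_eq y gs hmean
  refine ⟨fun b hb => ?_, hcrit, fun B' m hB' hm hmono => ?_⟩
  · have h₁ := hn.2.2 b (by omega)
    have h₂ := hn.2.2 (b + 1) hb
    have h₃ := hn.le_of_le (show b + 2 ≤ B from hb) le_rfl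
    rw [hn.2.1] at h₃
    rw [← hmean b (by omega) (n b) (left_mem_Ico.2 h₁),
      ← hmean (b + 1) hb (n (b + 1)) (left_mem_Ico.2 h₂)]
    exact hfit.1 _ _ h₁.le (h₂.trans_le h₃)
  · obtain ⟨h, hh, hstep⟩ := hm.exists_monotone_step hB' y hmono
    rw [hcrit, hm.binCrit_eq y h hstep]
    exact mul_le_mul_of_nonneg_left (hfit.2 h hh) (by positivity)
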